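/- The closed neighborhood ideal of any tree is normally torsion-free. -/

import Mathlib

open MvPolynomial

variable (K : Type*) [Field K]

open scoped Classical in
/-- The monomial `∏_{j ∈ N[v]} x_j` of the closed neighborhood of `v`. -/
noncomputable def nbhdMonomial {W : Type*} [Fintype W] (G : SimpleGraph W) (v : W) :
    MvPolynomial W K :=
  X v * ∏ j ∈ Finset.univ.filter (fun j => G.Adj v j), X j

/-- The closed neighborhood ideal of a graph. -/
noncomputable def NI {W : Type*} [Fintype W] (G : SimpleGraph W) : Ideal (MvPolynomial W K) :=
  Ideal.span (Set.range fun v => nbhdMonomial K G v)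

/-- `I` is normally torsion-free. -/
def NormallyTorsionFree {R : Type*} [CommRing R] (I : Ideal R) : Prop :=
  ∀ k : ℕ, 1 ≤ k → associatedPrimes R (R ⧸ I ^ k) ⊆ associatedPrimes R (R ⧸ I)

/-- In a tree, a vertex other than the root has only one neighbor closer to the root. -/
theorem SimpleGraph.IsTree.eq_of_adj_of_dist_lt {V : Type*} {G : SimpleGraph V} (hG : G.IsTree)
    (r : V) {u w v : V} (hu : G.Adj u v) (hw : G.Adj w v) (hdu : G.dist r u < G.dist r v)
    (hdw : G.dist r w < G.dist r v) : u = w := by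
  obtain ⟨p, hp⟩ := hG.connected.exists_walk_length_eq_dist r u
  obtain ⟨q, hq⟩ := hG.connected.exists_walk_length_eq_dist r w
  have hu' := hG.dist_eq_dist_add_one_of_adj r hu
  have hw' := hG.dist_eq_dist_add_one_of_adj r hw
  have hpath : (p.concat hu).IsPath :=
    Walk.isPath_of_length_eq_dist _ (by rw [Walk.length_concat]; omega)
  have hpath' : (q.concat hw).IsPath :=
    Walk.isPath_of_length_eq_dist _ (by rw [Walk.length_concat]; omega)
  have h := congrArg Walk.penultimate ((hG.existsUnique_path r v).unique hpath hpath')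
  simpa using h

/-- A family of hyperedges indexed by `S` has a simple member: one whose vertices are linearly
ordered by inclusion of their stars. -/
def HasSimpleEdge {ι V : Type*} (e : ι → Finset V) (S : Finset ι) : Prop :=
  ∃ i ∈ S, ∀ u ∈ e i, ∀ w ∈ e i,
    (∀ j ∈ S, u ∈ e j → w ∈ e j) ∨ (∀ j ∈ S, w ∈ e j → u ∈ e j)

open scoped Classical in
/-- The closed neighborhood of a vertex. -/
noncomputable def closedNbhd {W : Type*} [Fintype W] (G : SimpleGraph W) (v : W) : Finset W :=
  insert v (Finset.univ.filter fun j => G.Adj v j)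

theorem mem_closedNbhd {W : Type*} [Fintype W] {G : SimpleGraph W} {v w : W} :
    w ∈ closedNbhd G v ↔ w = v ∨ G.Adj v w := by
  simp [closedNbhd]

theorem nbhdMonomial_eq_prod {W : Type*} [Fintype W] (G : SimpleGraph W) (v : W) :
    nbhdMonomial K G v = ∏ j ∈ closedNbhd G v, X j := by
  classical
  rw [closedNbhd, Finset.prod_insert (by simp), nbhdMonomial]

/-- Every nonempty family of closed neighborhoods of a tree has a simple member. -/
theorem hasSimpleEdge_closedNbhd {W : Type*} [Fintype W] {G : SimpleGraph W} (hG : G.IsTree)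
    {S : Finset W} (hS : S.Nonempty) : HasSimpleEdge (closedNbhd G) S := by
  obtain ⟨r, hr⟩ := hS
  obtain ⟨v, hv, hmax⟩ := S.exists_max_image (G.dist r) ⟨r, hr⟩
  have key : ∀ u ∈ closedNbhd G v, ∀ w ∈ closedNbhd G v, G.dist r u ≥ G.dist r w →
      ∀ j ∈ S, u ∈ closedNbhd G j → w ∈ closedNbhd G j := by
    intro u hu w hw hle j hj huj
    have hjv := hmax j hj
    simp only [mem_closedNbhd] at *
    have parent_unique := @SimpleGraph.IsTree.eq_of_adj_of_dist_lt _ _ hG r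
    have level := @SimpleGraph.IsTree.dist_eq_dist_add_one_of_adj _ _ hG r
    grind [SimpleGraph.Adj.symm]
  exact ⟨v, hv, fun u hu w hw => (le_total (G.dist r w) (G.dist r u)).imp (key u hu w hw)
    (key w hw u hu)⟩

/-- Weighted covering-packing duality for hypergraphs all of whose subfamilies have a simple edge,
phrased as membership of a monomial in a power of the edge ideal. -/
theorem exists_cover_monomial_mem_pow {ι V : Type*} [DecidableEq V] [DecidableEq ι]
    (e : ι → Finset V) (I : Ideal (MvPolynomial V K)) (he : ∀ i, (e i).Nonempty)
    (hI : ∀ i, ∏ u ∈ e i, X u ∈ I) (hsimple : ∀ S : Finset ι, S.Nonempty → HasSimpleEdge e S)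
    (S : Finset ι) (a : V →₀ ℕ) :
    ∃ C : Finset V, (∀ i ∈ S, ∃ u ∈ C, u ∈ e i) ∧ monomial a 1 ∈ I ^ ∑ u ∈ C, a u := by
  induction S using Finset.strongInduction generalizing a with
  | H S ih =>
  rcases S.eq_empty_or_nonempty with rfl | hS
  · exact ⟨∅, by simp⟩
  obtain ⟨i, hi, hchain⟩ := hsimple S hS
  obtain ⟨u₀, hu₀, hmin⟩ := (e i).exists_min_image a (he i)
  set b : V →₀ ℕ := ∑ u ∈ e i, Finsupp.single u (a u₀) with hb
  have hbapp : ∀ u, b u = if u ∈ e i then a u₀ else 0 := by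
    intro u
    simp [hb, Finsupp.finsetSum_apply, Finsupp.single_apply]
  have hba : b ≤ a := by
    intro u
    rw [hbapp]
    split_ifs with h
    exacts [hmin u h, Nat.zero_le _]
  have hbmon : (monomial b (1 : K)) = (∏ u ∈ e i, X u) ^ a u₀ := by
    simp [hb, monomial_sum_one, X_pow_eq_monomial, ← Finset.prod_pow]
  obtain ⟨C, hC, hmem⟩ := ih (S.erase i) (Finset.erase_ssubset hi) (a - b)
  obtain ⟨w, hw, hwstar, hwle⟩ : ∃ w ∈ e i,
      (∀ j ∈ S, j ≠ i → (∃ u ∈ C, u ∈ e i ∧ u ∈ e j) → w ∈ e j) ∧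
      (a - b) w ≤ ∑ u ∈ C with u ∈ e i, (a - b) u := by
    rcases (C.filter (· ∈ e i)).eq_empty_or_nonempty with hemp | hne
    · refine ⟨u₀, hu₀, ?_, ?_⟩
      · rintro j - - ⟨u, huC, hui, -⟩
        exact absurd (Finset.mem_filter.2 ⟨huC, hui⟩) (by simp [hemp])
      · simp [hemp, hbapp, hu₀]
    · obtain ⟨w, hwC, hwmax⟩ := (C.filter (· ∈ e i)).exists_max_image
        (fun u => (S.filter (u ∈ e ·)).card) hne
      have hwi := (Finset.mem_filter.1 hwC).2
      refine ⟨w, hwi, ?_, Finset.single_le_sum (f := fun u => (a - b) u)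
        (fun _ _ => Nat.zero_le _) hwC⟩
      rintro j hj - ⟨u, huC, hui, huj⟩
      rcases hchain u hui w hwi with h | h
      · exact h j hj huj
      · have hsub : S.filter (w ∈ e ·) ⊆ S.filter (u ∈ e ·) := fun k hk =>
          Finset.mem_filter.2 ⟨(Finset.mem_filter.1 hk).1,
            h k (Finset.mem_filter.1 hk).1 (Finset.mem_filter.1 hk).2⟩
        have heq := Finset.eq_of_subset_of_card_le hsub
          (hwmax u (Finset.mem_filter.2 ⟨huC, hui⟩))
        have hjw : j ∈ S.filter (w ∈ e ·) := heq ▸ Finset.mem_filter.2 ⟨hj, huj⟩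
        exact (Finset.mem_filter.1 hjw).2
  refine ⟨insert w (C.filter (· ∉ e i)), ?_, ?_⟩
  · intro j hj
    by_cases hji : j = i
    · exact ⟨w, Finset.mem_insert_self _ _, hji ▸ hw⟩
    obtain ⟨u, huC, huj⟩ := hC j (Finset.mem_erase.2 ⟨hji, hj⟩)
    by_cases hui : u ∈ e i
    · exact ⟨w, Finset.mem_insert_self _ _, hwstar j hj hji ⟨u, huC, hui, huj⟩⟩
    · exact ⟨u, Finset.mem_insert_of_mem (Finset.mem_filter.2 ⟨huC, hui⟩), huj⟩
  · have hsum : ∑ u ∈ insert w (C.filter (· ∉ e i)), a u ≤ ∑ u ∈ C, (a - b) u + a u₀ := by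
      rw [Finset.sum_insert (by simp [hw]), ← Finset.sum_filter_add_sum_filter_not C (· ∈ e i)]
      have h₁ : ∑ u ∈ C with u ∉ e i, a u = ∑ u ∈ C with u ∉ e i, (a - b) u :=
        Finset.sum_congr rfl fun u hu => by simp [hbapp, (Finset.mem_filter.1 hu).2]
      have h₂ : a w = (a - b) w + a u₀ := by
        simp [hbapp, hw, Nat.sub_add_cancel (hmin w hw)]
      omega
    refine Ideal.pow_le_pow_right hsum ?_
    have hsplit : (monomial a (1 : K)) = monomial (a - b) 1 * monomial b 1 := by
      rw [monomial_mul, one_mul, tsub_add_cancel_of_le hba]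
    rw [hsplit, pow_add, hbmon]
    exact Ideal.mul_mem_mul hmem (Ideal.pow_mem_pow (hI i) _)

open scoped Classical in
/-- The substitution `x_i ↦ x_i t` for `i ∈ C` and `x_i ↦ x_i` otherwise. The order in `t` of the
image of a polynomial is its order along the prime generated by the variables in `C`. -/
noncomputable def tagVars {V : Type*} (C : Finset V) :
    MvPolynomial V K →ₐ[K] Polynomial (MvPolynomial V K) :=
  aeval fun i => Polynomial.C (X i) * (if i ∈ C then Polynomial.X else 1)

theorem tagVars_monomial {V : Type*} (C : Finset V) (a : V →₀ ℕ) (c : K) :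
    tagVars K C (monomial a c) = Polynomial.monomial (∑ u ∈ C, a u) (monomial a c) := by
  classical
  have hX : (∏ i ∈ a.support, (if i ∈ C then (Polynomial.X : Polynomial (MvPolynomial V K))
      else 1) ^ a i) = Polynomial.X ^ ∑ u ∈ C, a u := by
    simp only [ite_pow, one_pow]
    rw [Finset.prod_ite, Finset.prod_const_one, mul_one, Finset.prod_pow_eq_pow_sum]
    congr 1
    rw [Finset.filter_mem_eq_inter, Finset.inter_comm, ← Finset.filter_mem_eq_inter]
    exact Finset.sum_filter_of_ne fun u _ h => by simpa using h
  rw [tagVars, aeval_monomial, Finsupp.prod]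
  simp only [mul_pow, Finset.prod_mul_distrib, hX]
  rw [← mul_assoc, ← Polynomial.C_mul_X_pow_eq_monomial, monomial_eq, Finsupp.prod]
  simp only [Polynomial.algebraMap_apply, MvPolynomial.algebraMap_eq, map_mul, map_prod, map_pow]

theorem coeff_coeff_tagVars {V : Type*} (C : Finset V) (f : MvPolynomial V K) (a : V →₀ ℕ) :
    coeff a ((tagVars K C f).coeff (∑ u ∈ C, a u)) = coeff a f := by
  classical
  induction f using MvPolynomial.induction_on' with
  | monomial b c =>
    rw [tagVars_monomial, Polynomial.coeff_monomial]
    by_cases h : b = a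
    · simp [h]
    · split_ifs <;> simp [h]
  | add p q hp hq => simp [hp, hq]

theorem le_sum_of_X_pow_dvd_tagVars {V : Type*} {C : Finset V} {f : MvPolynomial V K} {k : ℕ}
    (h : Polynomial.X ^ k ∣ tagVars K C f) {a : V →₀ ℕ} (ha : a ∈ f.support) :
    k ≤ ∑ u ∈ C, a u := by
  by_contra! hlt
  rw [mem_support_iff, ← coeff_coeff_tagVars K C, Polynomial.X_pow_dvd_iff.1 h _ hlt] at ha
  exact ha (coeff_zero a)

/-- A hypergraph on finitely many vertices, all of whose subfamilies have a simple edge, has a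
normally torsion-free edge ideal. -/
theorem normallyTorsionFree_span_prod {ι V : Type*} [Finite V] [Fintype ι] (e : ι → Finset V)
    (he : ∀ i, (e i).Nonempty) (hsimple : ∀ S : Finset ι, S.Nonempty → HasSimpleEdge e S) :
    NormallyTorsionFree (Ideal.span (Set.range fun i => ∏ u ∈ e i, (X u : MvPolynomial V K))) := by
  classical
  cases nonempty_fintype V
  set I := Ideal.span (Set.range fun i => ∏ u ∈ e i, (X u : MvPolynomial V K)) with hIdef
  have hI : ∀ i, ∏ u ∈ e i, X u ∈ I := fun i => Ideal.subset_span ⟨i, rfl⟩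
  intro k hk p hp
  obtain ⟨hprime, x, hx⟩ := hp
  obtain ⟨f, rfl⟩ := Ideal.Quotient.mk_surjective x
  have hmem : ∀ r, r ∈ p ↔ ∃ m, r ^ m * f ∈ I ^ k := by
    intro r
    rw [hx, Ideal.mem_radical_iff]
    refine exists_congr fun m => ?_
    rw [Submodule.mem_colon_singleton, Submodule.mem_bot, ← Ideal.Quotient.eq_zero_iff_mem]
    rfl
  have hIp : I ≤ p := fun r hr =>
    (hmem r).2 ⟨k, Ideal.mul_mem_right _ _ (Ideal.pow_mem_pow hr k)⟩
  have hf : f ∉ I ^ k := fun hf =>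
    hprime.ne_top ((Ideal.eq_top_iff_one p).2 ((hmem 1).2 ⟨0, by simpa using hf⟩))
  let IsCover : Finset V → Prop := fun C => ∀ i, ∃ u ∈ C, u ∈ e i
  obtain ⟨C, hC, hfC⟩ : ∃ C, Minimal IsCover C ∧ ¬ Polynomial.X ^ k ∣ tagVars K C f := by
    by_contra! hall
    refine hf ?_
    rw [f.as_sum]
    refine Ideal.sum_mem _ fun a ha => ?_
    obtain ⟨D, hD, hmon⟩ := exists_cover_monomial_mem_pow K e I he hI hsimple Finset.univ a
    obtain ⟨C, hCD, hC⟩ := exists_minimal_le_of_wellFoundedLT IsCover D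
      fun i => hD i (Finset.mem_univ i)
    have hle : k ≤ ∑ u ∈ D, a u := (le_sum_of_X_pow_dvd_tagVars K (hall C hC) ha).trans
      (Finset.sum_le_sum_of_subset hCD)
    rw [← mul_one (coeff a f), ← C_mul_monomial]
    exact Ideal.mul_mem_left _ _ (Ideal.pow_le_pow_right hle hmon)
  have hX : Prime (Polynomial.X : Polynomial (MvPolynomial V K)) := Polynomial.prime_X
  have hIC : I ≤ Ideal.comap (tagVars K C) (Ideal.span {Polynomial.X}) := by
    rw [hIdef, Ideal.span_le]
    rintro _ ⟨i, rfl⟩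
    obtain ⟨u, huC, hui⟩ := hC.prop i
    simp only [SetLike.mem_coe, Ideal.mem_comap, Ideal.mem_span_singleton, map_prod]
    refine Dvd.dvd.trans ?_ (Finset.dvd_prod_of_mem _ hui)
    simp [tagVars, huC]
  have hpC : ∀ r ∈ p, Polynomial.X ∣ tagVars K C r := by
    intro r hr
    obtain ⟨m, hm⟩ := (hmem r).1 hr
    by_contra hndvd
    have hpow := Ideal.le_comap_pow (tagVars K C) k (Ideal.pow_right_mono hIC k hm)
    rw [Ideal.mem_comap, Ideal.span_singleton_pow, Ideal.mem_span_singleton, map_mul,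
      map_pow] at hpow
    exact hfC (hX.pow_dvd_of_dvd_mul_left k (fun h => hndvd (hX.dvd_of_dvd_pow h)) hpow)
  have hmin : p ∈ I.minimalPrimes := by
    refine ⟨⟨hprime, hIp⟩, fun q hq hqp r hr => ?_⟩
    have hcover : IsCover (C.filter fun u => X u ∈ q) := by
      intro i
      obtain ⟨u, hui, huq⟩ := (Ideal.IsPrime.prod_mem_iff (hp := hq.1)).1 (hq.2 (hI i))
      refine ⟨u, Finset.mem_filter.2 ⟨?_, huq⟩, hui⟩
      by_contra huC
      have hdvd := hpC _ (hqp huq)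
      simp [tagVars, huC, Polynomial.X_dvd_iff] at hdvd
    have hCq : ∀ u ∈ C, X u ∈ q := fun u hu =>
      (Finset.mem_filter.1 (hC.le_of_le hcover (Finset.filter_subset _ _) hu)).2
    rw [r.as_sum]
    refine Ideal.sum_mem _ fun a ha => ?_
    have hle := le_sum_of_X_pow_dvd_tagVars K (k := 1) (by simpa using hpC r hr) ha
    obtain ⟨u, huC, hu⟩ : ∃ u ∈ C, a u ≠ 0 := by
      by_contra! h
      rw [Finset.sum_eq_zero h] at hle
      omega
    exact Ideal.mem_of_dvd q (X_dvd_monomial.2 (Or.inr hu)) (hCq u huC)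
  have hann : Module.annihilator (MvPolynomial V K) (MvPolynomial V K ⧸ I) = I :=
    Ideal.annihilator_quotient
  exact Module.associatedPrimes.minimalPrimes_annihilator_subset_associatedPrimes _ _
    (hann.symm ▸ hmin)

/-- The closed neighborhood ideal of any tree is normally torsion-free. -/
theorem NI_tree_ntf {n : ℕ} (G : SimpleGraph (Fin n)) (hG : G.IsTree) :
    NormallyTorsionFree (NI K G) := by
  rw [NI]
  simp only [nbhdMonomial_eq_prod]
  exact normallyTorsionFree_span_prod K _ (fun v => ⟨v, mem_closedNbhd.2 (Or.inl rfl)⟩)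
    fun _ => hasSimpleEdge_closedNbhd hG
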